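/- arXiv:1002.0969 — 3 statements merged into one kernel-verified Lean document; each statement's English description precedes it below -/
import Mathlib

section
/- Let χ be a linear functional on W of height -1, 0 or 1 and let λ, λ' ∈ Λ(χ) with (λ, λ') ∉ Θ(χ) and λ + λ' = p-1 (this forces χ to have height at most 0). Then Ext(K_{λ'}, V_χ(λ)), taken in the category of W_0-modules with p-character χ (with V_χ(λ) regarded as a W_0-module by restriction), is isomorphic to K if [λ-λ'] ∈ {2, 3, 4}, or if [λ-λ'] = 6 and p = 19; and Ext(K_{λ'}, V_χ(λ)) = 0 otherwise. -/
/-!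
Common setup: the Witt algebra `W` over `K` (char `p > 3`) has basis
`e_{-1}, e_0, ..., e_{p-2}` with `[e_i, e_j] = (j-i) e_{i+j}` (and `e_k = 0`
outside the range), and `p`-mapping `e_i^{[p]} = δ_{i0} e_i`.  A module with
`p`-character `χ` over `W` (resp. the subalgebra `W_0 = <e_0, ..., e_{p-2}>`)
is given by a family of endomorphisms `ρ k` (`k : ℤ`, vanishing outside
`[lo, p-2]` where `lo = -1` for `W` and `lo = 0` for `W_0`) satisfying the
bracket relations and `(ρ i)^p - δ_{i0} ρ i = χ(e_i)^p • 1`.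

The Baer Ext space `Ext(N, M)` of two such modules, in the category of
modules with `p`-character `χ`, is realized concretely: an extension
`0 → M → E → N → 0` admits a linear splitting `E ≃ M ⊕ N`, under which the
action of `e_k` is `(m, n) ↦ (ρM k m + c k n, ρN k n)` for a "cocycle"
`c : ℤ → (N →ₗ M)`; the conditions for `E` to be a module with `p`-character
`χ` are the cocycle conditions below, Baer equivalence corresponds to
differing by a coboundary, and the Baer sum / scalar action correspond to the
linear structure on cocycles.  So `Ext(N, M) ≅ cocycles / coboundaries`.
-/

set_option maxHeartbeats 1000000
set_option synthInstance.maxHeartbeats 1000000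

noncomputable section

/-- The coefficient `(-1)^j · (i!/(i-j)!) · ((j+1)λ - i + j)` of the action
`e_j · v_i = (coefficient) · v_{i-j}` on the reduced Verma module; it vanishes
for `j > i` since then `Nat.descFactorial i j = 0`. -/
def wCoef (K : Type) [Field K] (lam : K) (j i : ℕ) : K :=
  (-1 : K) ^ j * (Nat.descFactorial i j : K) * (((j : K) + 1) * lam - (i : K) + (j : K))

/-- Matrices (in the basis `v_0, ..., v_{p-1}`) of the generators `e_j`
(`j : ℤ`) acting on the reduced Verma module `V_χ(λ)`; here `c = χ(e_{-1})^p`.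
`e_{-1} v_i = v_{i+1}` for `i < p-1`, `e_{-1} v_{p-1} = c v_0`, and for
`0 ≤ j ≤ p-2`, `e_j v_i = (-1)^j (i!/(i-j)!) ((j+1)λ - i + j) v_{i-j}`. -/
def vermaMat (K : Type) [Field K] (p : ℕ) (c lam : K) : ℤ → Matrix (Fin p) (Fin p) K :=
  fun j =>
    if j = -1 then
      Matrix.of fun k l =>
        if (k : ℕ) = (l : ℕ) + 1 then 1
        else if (k : ℕ) = 0 ∧ (l : ℕ) = p - 1 then c else 0
    else if 0 ≤ j ∧ j ≤ (p : ℤ) - 2 then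
      Matrix.of fun k l =>
        if (l : ℕ) = (k : ℕ) + j.toNat then wCoef K lam j.toNat (l : ℕ) else 0
    else 0

/-- The action of the basis elements `e_j` (`j : ℤ`) on the reduced Verma
module `V_χ(λ)`, with `c = χ(e_{-1})^p`. -/
def vermaRho (K : Type) [Field K] (p : ℕ) (c lam : K) : ℤ → Module.End K (Fin p → K) :=
  fun j => Matrix.toLin' (vermaMat K p c lam j)

/-- The one-dimensional `W_0`-module `K_λ`: `e_0` acts by `λ`, all other `e_j` act by `0`. -/
def oneDimRho (K : Type) [Field K] (lam : K) : ℤ → Module.End K K :=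
  fun j => if j = 0 then lam • (1 : Module.End K K) else 0

/-- The one-dimensional trivial module: every basis element acts by `0`. -/
def trivRho (K : Type) [Field K] : ℤ → Module.End K K := fun _ => 0

/-- The coefficient `(-1)^(j+1) · ((i+1)!/(i-j)!)` of the action
`e_j · u_i = (coefficient) · u_{i-j}` on the `(p-1)`-dimensional simple module `S`. -/
def sCoef (K : Type) [Field K] (j i : ℕ) : K :=
  (-1 : K) ^ (j + 1) * (Nat.descFactorial (i + 1) (j + 1) : K)

/-- Matrices (in the basis `u_0, ..., u_{p-2}`) of the generators `e_j` acting on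
the `(p-1)`-dimensional simple restricted module `S = V_0(p-1)/Soc(V_0(p-1))`. -/
def sMat (K : Type) [Field K] (p : ℕ) : ℤ → Matrix (Fin (p - 1)) (Fin (p - 1)) K :=
  fun j =>
    if j = -1 then
      Matrix.of fun k l => if (k : ℕ) = (l : ℕ) + 1 then 1 else 0
    else if 0 ≤ j ∧ j ≤ (p : ℤ) - 2 then
      Matrix.of fun k l =>
        if (l : ℕ) = (k : ℕ) + j.toNat then sCoef K j.toNat (l : ℕ) else 0
    else 0

/-- The action of the basis elements `e_j` on the simple module `S`. -/
def sRho (K : Type) [Field K] (p : ℕ) : ℤ → Module.End K (Fin (p - 1) → K) :=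
  fun j => Matrix.toLin' (sMat K p j)

section ExtSpace

variable (K : Type) [Field K] (M N : Type) [AddCommGroup M] [Module K M]
  [AddCommGroup N] [Module K N]

/-- Constraint: a cocycle vanishes outside the index range `[lo, p-2]`. -/
def suppConstraint (p : ℕ) (lo k : ℤ) : (ℤ → N →ₗ[K] M) →ₗ[K] (N →ₗ[K] M) :=
  if k < lo ∨ (p : ℤ) - 2 < k then LinearMap.proj k else 0

variable {M N}

/-- Constraint on a cocycle coming from the bracket relation
`[e_i, e_j] = (j - i) e_{i+j}`:
`(j-i) c(i+j) = ρM i ∘ c j + c i ∘ ρN j - ρM j ∘ c i - c j ∘ ρN i`. -/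
def bracketConstraint (p : ℕ) (lo : ℤ) (ρM : ℤ → Module.End K M)
    (ρN : ℤ → Module.End K N) (i j : ℤ) :
    (ℤ → N →ₗ[K] M) →ₗ[K] (N →ₗ[K] M) :=
  if lo ≤ i ∧ i ≤ (p : ℤ) - 2 ∧ lo ≤ j ∧ j ≤ (p : ℤ) - 2 then
    ((j - i : ℤ) : K) • LinearMap.proj (i + j)
      - LinearMap.llcomp K N M M (ρM i) ∘ₗ LinearMap.proj j
      - LinearMap.lcomp K M (ρN j) ∘ₗ LinearMap.proj i
      + LinearMap.llcomp K N M M (ρM j) ∘ₗ LinearMap.proj i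
      + LinearMap.lcomp K M (ρN i) ∘ₗ LinearMap.proj j
  else 0

/-- Constraint on a cocycle expressing that the extension has `p`-character `χ`:
on the extension `E = M ⊕ N` the `(N → M)`-component of `(e_i)^p` is
`∑_{k<p} (ρM i)^k ∘ c i ∘ (ρN i)^(p-1-k)`, and this must agree with the
`(N → M)`-component of `e_i^{[p]} + χ(e_i)^p • 1`, which is `δ_{i0} c i`
(the scalar `χ(e_i)^p` contributes nothing off the diagonal, and the diagonal
blocks hold since `M`, `N` have `p`-character `χ`). -/
def pcharConstraint (p : ℕ) (lo : ℤ) (ρM : ℤ → Module.End K M)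
    (ρN : ℤ → Module.End K N) (i : ℤ) :
    (ℤ → N →ₗ[K] M) →ₗ[K] (N →ₗ[K] M) :=
  if lo ≤ i ∧ i ≤ (p : ℤ) - 2 then
    (∑ k ∈ Finset.range p,
        LinearMap.llcomp K N M M ((ρM i) ^ k) ∘ₗ
          LinearMap.lcomp K M ((ρN i) ^ (p - 1 - k)) ∘ₗ LinearMap.proj i)
      - (if i = 0 then (LinearMap.proj 0 : (ℤ → N →ₗ[K] M) →ₗ[K] (N →ₗ[K] M)) else 0)
  else 0

/-- The space of cocycles: families `c : ℤ → (N →ₗ M)` (the values of a linear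
map `W → Hom(N, M)` on the basis, `lo = -1` for `W` and `lo = 0` for `W_0`)
such that `M ⊕ N` with action `e_k (m, n) = (ρM k m + c k n, ρN k n)` is a
module with `p`-character `χ`. -/
def cocycles (p : ℕ) (lo : ℤ) (ρM : ℤ → Module.End K M) (ρN : ℤ → Module.End K N) :
    Submodule K (ℤ → N →ₗ[K] M) :=
  (⨅ k : ℤ, LinearMap.ker (suppConstraint K M N p lo k)) ⊓
    (⨅ i : ℤ, ⨅ j : ℤ, LinearMap.ker (bracketConstraint K p lo ρM ρN i j)) ⊓
    (⨅ i : ℤ, LinearMap.ker (pcharConstraint K p lo ρM ρN i))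

/-- The coboundaries: cocycles of the form `k ↦ ρM k ∘ f - f ∘ ρN k` for a
linear map `f : N → M`; these are exactly the cocycles of split extensions,
and two cocycles give Baer-equivalent extensions iff they differ by a
coboundary. -/
def coboundaries (p : ℕ) (lo : ℤ) (ρM : ℤ → Module.End K M) (ρN : ℤ → Module.End K N) :
    Submodule K (ℤ → N →ₗ[K] M) :=
  LinearMap.range (LinearMap.pi fun k : ℤ =>
    if lo ≤ k ∧ k ≤ (p : ℤ) - 2 then
      LinearMap.llcomp K N M M (ρM k) - LinearMap.lcomp K M (ρN k)
    else 0)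

/-- The Baer Ext space `Ext(N, M)` in the category of modules with
`p`-character `χ` (over `W` if `lo = -1`, over `W_0` if `lo = 0`), realized
as cocycles modulo coboundaries. -/
abbrev extSpace (p : ℕ) (lo : ℤ) (ρM : ℤ → Module.End K M) (ρN : ℤ → Module.End K N) :=
  (cocycles K p lo ρM ρN) ⧸
    (Submodule.comap (cocycles K p lo ρM ρN).subtype (coboundaries K p lo ρM ρN))

end ExtSpace

end

section WittExt

variable {K : Type} [Field K]

/-- The coordinates of a vector of `Fin p → K`, extended by zero to all of `ℕ`. -/
def vcoord {p : ℕ} (x : Fin p → K) (m : ℕ) : K := if h : m < p then x ⟨m, h⟩ else 0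

lemma vcoord_of_le {p : ℕ} (x : Fin p → K) {m : ℕ} (h : p ≤ m) : vcoord x m = 0 := by
  simp [vcoord, Nat.not_lt.2 h]

lemma vcoord_apply {p : ℕ} (x : Fin p → K) (m : Fin p) : vcoord x m = x m := by
  simp [vcoord]

lemma vcoord_ext {p : ℕ} {x y : Fin p → K} (h : ∀ m, vcoord x m = vcoord y m) : x = y := by
  ext m
  have := h m
  rwa [vcoord_apply, vcoord_apply] at this

@[simp] lemma vcoord_add {p : ℕ} (x y : Fin p → K) (m : ℕ) :
    vcoord (x + y) m = vcoord x m + vcoord y m := by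
  by_cases h : m < p <;> simp [vcoord, h]

@[simp] lemma vcoord_sub {p : ℕ} (x y : Fin p → K) (m : ℕ) :
    vcoord (x - y) m = vcoord x m - vcoord y m := by
  by_cases h : m < p <;> simp [vcoord, h]

@[simp] lemma vcoord_smul {p : ℕ} (a : K) (x : Fin p → K) (m : ℕ) :
    vcoord (a • x) m = a * vcoord x m := by
  by_cases h : m < p <;> simp [vcoord, h]

@[simp] lemma vcoord_zero {p : ℕ} (m : ℕ) : vcoord (0 : Fin p → K) m = 0 := by
  by_cases h : m < p <;> simp [vcoord, h]

lemma vcoord_sum {ι : Type} {p : ℕ} (s : Finset ι) (x : ι → Fin p → K) (m : ℕ) :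
    vcoord (∑ k ∈ s, x k) m = ∑ k ∈ s, vcoord (x k) m := by
  by_cases h : m < p <;> simp [vcoord, h]

lemma vcoord_restrict {p : ℕ} (g : ℕ → K) (hg : ∀ m, p ≤ m → g m = 0) (m : ℕ) :
    vcoord (fun k : Fin p => g k) m = g m := by
  by_cases h : m < p
  · simp [vcoord, h]
  · simp [vcoord, h, hg m (not_lt.1 h)]

lemma vcoord_vermaRho {p : ℕ} (c lam : K) {j : ℕ} (hj : j + 2 ≤ p) (x : Fin p → K) (m : ℕ) :
    vcoord (vermaRho K p c lam j x) m = wCoef K lam j (m + j) * vcoord x (m + j) := by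
  by_cases hm : m < p
  · have h1 : ¬((j : ℤ) = -1) := by omega
    have h2 : (0 : ℤ) ≤ j ∧ (j : ℤ) ≤ (p : ℤ) - 2 := by omega
    simp only [vcoord, hm, dif_pos, vermaRho, vermaMat, h1, if_false, if_pos h2,
      Matrix.toLin'_apply, Matrix.mulVec, dotProduct, Matrix.of_apply, Int.toNat_natCast,
      ite_mul, zero_mul]
    by_cases h : m + j < p
    · rw [Finset.sum_eq_single (⟨m + j, h⟩ : Fin p)]
      · simp [h]
      · intro b _ hb
        rw [if_neg]
        intro hb'
        exact hb (Fin.ext hb')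
      · simp
    · rw [dif_neg h, mul_zero]
      refine Finset.sum_eq_zero fun b _ => if_neg ?_
      have := b.2
      omega
  · rw [vcoord_of_le _ (by omega), vcoord_of_le _ (by omega), mul_zero]

lemma wCoef_bracket (lam : K) (i j m : ℕ) :
    wCoef K lam i (m + i) * wCoef K lam j (m + i + j)
      - wCoef K lam j (m + j) * wCoef K lam i (m + j + i)
      = ((j : K) - i) * wCoef K lam (i + j) (m + (i + j)) := by
  have key : ∀ a b : ℕ, (((m + a + b).descFactorial b : ℕ) : K) * ((m + a).descFactorial a : ℕ)
      = ((m + (a + b)).descFactorial (a + b) : ℕ) := by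
    intro a b
    rw [← Nat.cast_mul]
    congr 1
    have := Nat.descFactorial_mul_descFactorial (n := m + (a + b)) (k := b) (m := a + b) (by omega)
    rw [← this, show a + b - b = a by omega, show m + (a + b) - b = m + a by omega,
      show m + a + b = m + (a + b) by omega, mul_comm]
  have k1 := key i j
  have k2 := key j i
  rw [add_comm j i] at k2
  simp only [wCoef]
  rw [← sub_eq_zero]
  push_cast
  linear_combination
    (-1 : K) ^ (i + j) * (((i : K) + 1) * lam - m) * (((j : K) + 1) * lam - m - i) * k1
    - (-1 : K) ^ (i + j) * (((j : K) + 1) * lam - m) * (((i : K) + 1) * lam - m - j) * k2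

/-- The bracket relations of a cocycle over `W_0` with values in `Hom(K_{lam'}, V(lam))`,
written in coordinates. -/
def IsCoordCocycle (p : ℕ) (lam lam' : K) (y : ℕ → ℕ → K) : Prop :=
  ∀ i j m : ℕ, i + 2 ≤ p → j + 2 ≤ p →
    ((j : K) - i) * y (i + j) m
      = wCoef K lam i (m + i) * y j (m + i) - wCoef K lam j (m + j) * y i (m + j)
        + (if j = 0 then lam' else 0) * y i m - (if i = 0 then lam' else 0) * y j m

/-- The coboundary of the vector with coordinates `g`, in coordinates. -/
def coordCoboundary (p : ℕ) (lam lam' : K) (g : ℕ → K) (j m : ℕ) : K :=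
  if j + 2 ≤ p then
    wCoef K lam j (m + j) * g (m + j) - (if j = 0 then lam' else 0) * g m
  else 0

lemma wCoef_zero (lam : K) (m : ℕ) : wCoef K lam 0 m = lam - m := by
  simp [wCoef]

lemma isCoordCocycle_coboundary {p : ℕ} [CharP K p] (lam lam' : K) (g : ℕ → K)
    (hg : ∀ m, p ≤ m → g m = 0) :
    IsCoordCocycle p lam lam' (coordCoboundary p lam lam' g) := by
  intro i j m hi hj
  have hb := wCoef_bracket lam i j m
  have hlow : ((j : K) - i) * coordCoboundary p lam lam' g (i + j) m =
      ((j : K) - i) * (wCoef K lam (i + j) (m + (i + j)) * g (m + (i + j))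
        - (if i + j = 0 then lam' else 0) * g m) := by
    unfold coordCoboundary
    split_ifs with h1 h2
    · rfl
    · rfl
    · omega
    · by_cases h3 : p ≤ m + (i + j)
      · simp [hg _ h3]
      · obtain rfl : m = 0 := by omega
        have hp : i + j + 1 = p := by omega
        have : (i : K) + j + 1 = 0 := by
          have := CharP.cast_eq_zero K p
          rw [← hp] at this
          exact_mod_cast this
        have hw : wCoef K lam (i + j) (0 + (i + j)) = 0 := by
          simp only [wCoef]
          push_cast
          linear_combination (-1 : K) ^ (i + j) * ((0 + (i + j)).descFactorial (i + j) : K)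
            * lam * this
        rw [hw]; ring
  rw [hlow]
  unfold coordCoboundary
  rw [if_pos hi, if_pos hj, if_pos hi, if_pos hj]
  rw [show m + (i + j) = m + i + j by omega] at *
  rw [show m + j + i = m + i + j by omega] at *
  rcases Nat.eq_zero_or_pos i with rfl | hi0 <;> rcases Nat.eq_zero_or_pos j with rfl | hj0
  · simp
  · simp only [Nat.add_zero, Nat.zero_add, if_true, Nat.cast_zero, hj0.ne', if_false] at *
    linear_combination (-g (m + j)) * hb
  · simp only [Nat.add_zero, Nat.zero_add, if_true, Nat.cast_zero, hi0.ne', if_false] at *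
    linear_combination (-g (m + i)) * hb
  · have : i + j ≠ 0 := by omega
    simp only [hi0.ne', hj0.ne', this, if_false]
    linear_combination (-g (m + i + j)) * hb

lemma IsCoordCocycle.sub {p : ℕ} {lam lam' : K} {y z : ℕ → ℕ → K}
    (hy : IsCoordCocycle p lam lam' y) (hz : IsCoordCocycle p lam lam' z) :
    IsCoordCocycle p lam lam' (y - z) := by
  intro i j m hi hj
  have h1 := hy i j m hi hj
  have h2 := hz i j m hi hj
  simp only [Pi.sub_apply]
  linear_combination h1 - h2

lemma natCast_ne_zero_of_lt {p : ℕ} [CharP K p] {a : ℕ} (h0 : 0 < a) (h : a < p) :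
    (a : K) ≠ 0 := by
  rw [Ne, CharP.cast_eq_zero_iff K p]
  exact fun hd => absurd (Nat.le_of_dvd h0 hd) (by omega)

lemma natCast_ne_of_lt {p : ℕ} [CharP K p] {a b : ℕ} (ha : a < p) (hb : b < p) (hab : a ≠ b) :
    (a : K) ≠ b := by
  intro h
  rw [CharP.natCast_eq_natCast K p] at h
  exact hab (Nat.ModEq.eq_of_lt_of_lt h ha hb)

/-- Modulo coboundaries, a cocycle vanishes on `e_0` and on `e_2`. -/
lemma exists_normalized {p d : ℕ} [CharP K p] (hp : 3 < p) (hd2 : 2 ≤ d) (hdp : d + 2 ≤ p)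
    {lam lam' : K} (h2 : 2 * lam = d - 1) (hl : lam' = lam - d) {y : ℕ → ℕ → K}
    (hy : IsCoordCocycle p lam lam' y) (hsupp : ∀ j m, p ≤ m → y j m = 0)
    (h0 : y 0 d = 0) :
    ∃ g : ℕ → K, (∀ m, p ≤ m → g m = 0) ∧
      (∀ m, (y - coordCoboundary p lam lam' g) 0 m = 0) ∧
      (∀ m, (y - coordCoboundary p lam lam' g) 2 m = 0) ∧
      (∀ m, m ≠ d - 1 → (y - coordCoboundary p lam lam' g) 1 m = 0) := by
  obtain ⟨n, rfl⟩ : ∃ n, d = n + 2 := ⟨d - 2, by omega⟩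
  have hw2 : wCoef K lam 2 (n + 2) ≠ 0 := by
    have e : 2 * wCoef K lam 2 (n + 2) =
        ((n + 2 : ℕ) : K) * ((n + 1 : ℕ) : K) * ((n + 3 : ℕ) : K) := by
      simp only [wCoef, Nat.descFactorial_succ, Nat.descFactorial_zero]
      push_cast at h2 ⊢
      linear_combination 3 * ((n : K) + 1) * (n + 2) * h2
    intro h
    rw [h, mul_zero] at e
    refine mul_ne_zero (mul_ne_zero ?_ ?_) ?_ e.symm <;>
      exact natCast_ne_zero_of_lt (p := p) (by omega) (by omega)
  set g : ℕ → K := fun m =>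
    if m = n + 2 then y 2 n / wCoef K lam 2 (n + 2)
    else if m < p then y 0 m / (lam - m - lam') else 0 with hgdef
  have hg : ∀ m, p ≤ m → g m = 0 := by
    intro m hm
    simp [hgdef, show ¬ m < p by omega, show ¬ m = n + 2 by omega]
  have hz := hy.sub (isCoordCocycle_coboundary lam lam' g hg)
  have hzs : ∀ j m, p ≤ m → (y - coordCoboundary p lam lam' g) j m = 0 := by
    intro j m hm
    simp only [Pi.sub_apply, coordCoboundary, hsupp j m hm, hg m hm, hg (m + j) (by omega)]
    simp
  have hz0 : ∀ m, (y - coordCoboundary p lam lam' g) 0 m = 0 := by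
    intro m
    by_cases hm : m < p
    · simp only [Pi.sub_apply, coordCoboundary, wCoef_zero, Nat.add_zero, if_true]
      rw [if_pos (by omega)]
      by_cases hmd : m = n + 2
      · subst hmd
        rw [h0, hl]
        push_cast
        ring
      · have : lam - m - lam' ≠ 0 := by
          rw [hl]
          intro h
          refine natCast_ne_of_lt (K := K) (p := p) (a := n + 2) (b := m) (by omega) hm
            (Ne.symm hmd) ?_
          linear_combination h
        simp only [hgdef, if_neg hmd, if_pos hm]
        field_simp
        ring
    · exact hzs 0 m (by omega)
  have hzj : ∀ j m, j + 2 ≤ p → 1 ≤ j → (y - coordCoboundary p lam lam' g) j m ≠ 0 →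
      ((j + m : ℕ) : K) = (n + 2 : ℕ) := by
    intro j m hj hj1 hne
    have h := hz 0 j m (by omega) hj
    rw [hz0, wCoef_zero, if_neg (by omega), if_pos rfl, Nat.zero_add, Nat.add_zero] at h
    apply mul_right_cancel₀ hne
    push_cast at h hl ⊢
    linear_combination h - (y - coordCoboundary p lam lam' g) j m * hl
  refine ⟨g, hg, hz0, ?_, ?_⟩
  · intro m
    by_contra hne
    have h := hzj 2 m (by omega) (by omega) hne
    have hmp : m < p := by
      by_contra hm
      exact hne (hzs _ _ (by omega))
    obtain rfl : m = n := by
      by_contra hmn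
      refine natCast_ne_of_lt (K := K) (p := p) hmp (by omega) hmn ?_
      push_cast at h
      linear_combination h
    apply hne
    simp only [Pi.sub_apply, coordCoboundary]
    rw [if_pos (by omega), if_neg (by omega)]
    simp only [hgdef, if_true]
    field_simp
    ring
  · intro m hm
    by_contra hne
    have h := hzj 1 m (by omega) (by omega) hne
    have hmp : m < p := by
      by_contra hm
      exact hne (hzs _ _ (by omega))
    refine natCast_ne_of_lt (K := K) (p := p) hmp (b := n + 1) (by omega) hm ?_
    push_cast at h ⊢
    linear_combination h

/-- A cocycle vanishing on `e_0`, `e_1` and `e_2` vanishes. -/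
lemma IsCoordCocycle.eq_zero {p : ℕ} [CharP K p] {lam lam' : K} {z : ℕ → ℕ → K}
    (hz : IsCoordCocycle p lam lam' z) (h0 : ∀ m, z 0 m = 0) (h1 : ∀ m, z 1 m = 0)
    (h2 : ∀ m, z 2 m = 0) (j : ℕ) (hj : j + 2 ≤ p) (m : ℕ) : z j m = 0 := by
  induction j generalizing m with
  | zero => exact h0 m
  | succ j ih =>
    by_cases hj2 : 2 ≤ j
    · have h := hz 1 j m (by omega) (by omega)
      rw [ih (by omega), h1, h1, if_neg (by omega), if_neg (by omega), Nat.add_comm 1 j] at h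
      have hne : ((j : K) - (1 : ℕ)) ≠ 0 :=
        sub_ne_zero.2 (natCast_ne_of_lt (p := p) (by omega) (by omega) (by omega))
      refine (mul_eq_zero.1 ?_).resolve_left hne
      rw [h]
      ring
    · obtain rfl | rfl : j = 0 ∨ j = 1 := by omega
      · exact h1 m
      · exact h2 m

/-- The bracket relations in the weight of the generator of `K_{lam'}`. -/
lemma IsCoordCocycle.weight {p : ℕ} {lam lam' : K} {z : ℕ → ℕ → K}
    (hz : IsCoordCocycle p lam lam' z) (i j m : ℕ) (hi : 1 ≤ i) (hj : 1 ≤ j) (hip : i + 2 ≤ p)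
    (hjp : j + 2 ≤ p) :
    ((j : K) - i) * z (i + j) m
      = wCoef K lam i (m + i) * z j (m + i) - wCoef K lam j (m + j) * z i (m + j) := by
  simpa [show i ≠ 0 by omega, show j ≠ 0 by omega] using hz i j m hip hjp

/-- The obstruction in degree `5`. -/
lemma obstruction_five {p n : ℕ} (hdp : n + 5 + 2 ≤ p) {lam lam' : K}
    (hn : (n : K) = 2 * lam - 4) {z : ℕ → ℕ → K}
    (hz : IsCoordCocycle p lam lam' z) (h2 : ∀ m, z 2 m = 0) :
    ((n : K) + 1) * (n + 2) * (n + 3) * (n + 4) * (3 * (n + 5) + 1) * (n + 5 + 1)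
      * z 1 (n + 4) = 0 := by
  have e12 := hz.weight 1 2 (n + 2) (by omega) (by omega) (by omega) (by omega)
  have e13 := hz.weight 1 3 (n + 1) (by omega) (by omega) (by omega) (by omega)
  have e14 := hz.weight 1 4 n (by omega) (by omega) (by omega) (by omega)
  have e23 := hz.weight 2 3 n (by omega) (by omega) (by omega) (by omega)
  simp only [h2, Nat.add_assoc, Nat.reduceAdd, wCoef, Nat.descFactorial_succ,
    Nat.descFactorial_zero, Nat.sub_zero, Nat.reduceSubDiff] at e12 e13 e14 e23
  push_cast at e12 e13 e14 e23
  rw [hn] at e12 e13 e14 e23 ⊢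
  linear_combination 12 * e23 - 4 * e14 + 8 * (2 * lam - 3) * e13
    + (12 * (2 * lam - 2) * (2 * lam - 3) * (lam + 4)
      - 24 * (2 * lam - 3) * (2 * lam - 2)) * e12

/-- The obstruction in degree `7`, when the one in degree `5` vanishes. -/
lemma obstruction_seven {p n : ℕ} (hdp : n + 7 + 2 ≤ p) {lam lam' : K}
    (hn : (n : K) = 2 * lam - 6) (h3 : 3 * lam = -2) {z : ℕ → ℕ → K}
    (hz : IsCoordCocycle p lam lam' z) (h2 : ∀ m, z 2 m = 0) :
    ((n : K) + 1) * (n + 2) * (n + 3) * (n + 4) * (n + 5) * (n + 6)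
      * z 1 (n + 6) = 0 := by
  have e12 := hz.weight 1 2 (n + 4) (by omega) (by omega) (by omega) (by omega)
  have e15 := hz.weight 1 5 (n + 1) (by omega) (by omega) (by omega) (by omega)
  have e23 := hz.weight 2 3 (n + 2) (by omega) (by omega) (by omega) (by omega)
  have e16 := hz.weight 1 6 n (by omega) (by omega) (by omega) (by omega)
  have e25 := hz.weight 2 5 n (by omega) (by omega) (by omega) (by omega)
  simp only [h2, Nat.add_assoc, Nat.reduceAdd, wCoef, Nat.descFactorial_succ,
    Nat.descFactorial_zero, Nat.sub_zero, Nat.reduceSubDiff] at e12 e15 e23 e16 e25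
  push_cast at e12 e15 e23 e16 e25
  rw [hn] at e12 e15 e23 e16 e25 ⊢
  generalize z 1 (n + 6) = a1 at *
  generalize z 3 (n + 4) = a3 at *
  generalize z 5 (n + 2) = a5 at *
  generalize z 6 (n + 1) = a6 at *
  generalize z 7 n = a7 at *
  clear hz h2 hn hdp
  have f12 : 27 * a3 = -112 * a1 := by clear e15 e23 e16 e25; grind
  have f23 : 27 * a5 = 1300 * a3 := by clear e15 e12 e16 e25; grind
  have f25 : 81 * a7 = 4864 * a5 := by clear e15 e12 e16 e23; grind
  have f15 : 2916 * a6 = 19440 * a5 - 407680 * a1 := by clear e12 e16 e23 e25; grind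
  have f16 : 10935 * a7 = 83106 * a6 - 8852480 * a1 := by clear e12 e15 e23 e25; grind
  have f : 1106560 * a1 = 0 := by
    linear_combination (-27) * (2 * f16 - 270 * f25 + 57 * f15) + 7600 * (27 * f23 + 1300 * f12)
  have fP : 729 * ((2 * lam - 6 + 1) * (2 * lam - 6 + 2) * (2 * lam - 6 + 3) * (2 * lam - 6 + 4)
      * (2 * lam - 6 + 5) * (2 * lam - 6 + 6)) = 1106560 := by
    clear e12 e15 e23 e16 e25
    grind
  have h729 : (729 : K) ≠ 0 := by
    intro h
    have h3' : (3 : K) = 0 := pow_eq_zero_iff (n := 6) (by norm_num) |>.1 (by linear_combination h)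
    exact one_ne_zero (α := K) (by linear_combination (1 + lam) * h3' - h3)
  apply mul_left_cancel₀ h729
  linear_combination f + a1 * fP

/-- Away from the exceptional cases a normalized cocycle vanishes on `e_1`. -/
lemma obstruction {p d : ℕ} [CharP K p] (hpp : p.Prime) (hd5 : 5 ≤ d) (hdp : d + 2 ≤ p)
    (hex : ¬(d = 6 ∧ p = 19)) {lam lam' : K} (h2 : 2 * lam = d - 1) {z : ℕ → ℕ → K}
    (hz : IsCoordCocycle p lam lam' z) (hz2 : ∀ m, z 2 m = 0) : z 1 (d - 1) = 0 := by
  have hc : ∀ a : ℕ, 0 < a → a < p → (a : K) ≠ 0 := fun a h0 h => natCast_ne_zero_of_lt h0 h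
  obtain ⟨n, rfl⟩ : ∃ n, d = n + 5 := ⟨d - 5, by omega⟩
  rw [show n + 5 - 1 = n + 4 by omega]
  have hn : (n : K) = 2 * lam - 4 := by push_cast at h2; linear_combination -h2
  have h5 := obstruction_five hdp hn hz hz2
  by_contra hne
  have a1 := hc (n + 1) (by omega) (by omega)
  have a2 := hc (n + 2) (by omega) (by omega)
  have a3 := hc (n + 3) (by omega) (by omega)
  have a4 := hc (n + 4) (by omega) (by omega)
  have a6 := hc (n + 6) (by omega) (by omega)
  have h16 : ((3 * n + 16 : ℕ) : K) = 0 := by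
    have e : (((n + 1 : ℕ) : K) * (n + 2 : ℕ) * (n + 3 : ℕ) * (n + 4 : ℕ) * (n + 6 : ℕ)
        * z 1 (n + 4)) * ((3 * n + 16 : ℕ) : K) = 0 := by
      push_cast
      linear_combination h5
    refine (mul_eq_zero.1 e).resolve_left ?_
    simp only [mul_ne_zero_iff]
    exact ⟨⟨⟨⟨⟨a1, a2⟩, a3⟩, a4⟩, a6⟩, hne⟩
  have hdvd := (CharP.cast_eq_zero_iff K p _).1 h16
  match n, hdvd with
  | 0, hdvd =>
    have := (Nat.Prime.dvd_of_dvd_pow hpp (show p ∣ 2 ^ 4 from hdvd))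
    exact absurd (Nat.le_of_dvd (by norm_num) this) (by omega)
  | 1, hdvd =>
    have := (Nat.prime_dvd_prime_iff_eq hpp (by norm_num : Nat.Prime 19)).1 hdvd
    exact hex ⟨rfl, this⟩
  | n + 2, _ =>
    have hn' : (n : K) = 2 * lam - 6 := by push_cast at hn; linear_combination hn
    have h3 : 3 * lam = -2 := by
      push_cast at h16 hn
      have e : (2 : K) * (3 * lam + 2) = 0 := by linear_combination h16 - 3 * hn
      have := (mul_eq_zero.1 e).resolve_left
        (by exact_mod_cast hc 2 (by omega) (by omega))
      linear_combination this
    have h7 := obstruction_seven hdp hn' h3 hz hz2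
    have b1 := hc (n + 1) (by omega) (by omega)
    have b2 := hc (n + 2) (by omega) (by omega)
    push_cast at a1 a2 a3 a4 b1 b2 h7
    refine absurd h7 ?_
    simp only [mul_ne_zero_iff]
    refine ⟨⟨⟨⟨⟨⟨b1, b2⟩, ?_⟩, ?_⟩, ?_⟩, ?_⟩, hne⟩
    · convert a1 using 1; ring
    · convert a2 using 1; ring
    · convert a3 using 1; ring
    · convert a4 using 1; ring

lemma vcoord_cocycle {p : ℕ} {c lam lam' : K} {f : ℤ → K →ₗ[K] (Fin p → K)}
    (hf : f ∈ cocycles K p 0 (vermaRho K p c lam) (oneDimRho K lam')) :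
    IsCoordCocycle p lam lam' fun j m => vcoord (f j 1) m := by
  intro i j m hi hj
  simp only [cocycles, Submodule.mem_inf, Submodule.mem_iInf, LinearMap.mem_ker] at hf
  have h := hf.1.2 i j
  rw [bracketConstraint, if_pos (by omega)] at h
  have h' := congrArg (fun u => vcoord (u 1) m) h
  have hN : ∀ a b : ℕ, vcoord (f a (oneDimRho K lam' b 1)) m
      = (if b = 0 then lam' else 0) * vcoord (f a 1) m := by
    intro a b
    have : oneDimRho K lam' b 1 = (if b = 0 then lam' else 0) • (1 : K) := by
      by_cases hb : b = 0 <;> simp [oneDimRho, hb]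
    rw [this, map_smul, vcoord_smul]
  simp only [LinearMap.add_apply, LinearMap.sub_apply, LinearMap.smul_apply, LinearMap.comp_apply,
    LinearMap.proj_apply, LinearMap.llcomp_apply, LinearMap.lcomp_apply, vcoord_add, vcoord_sub,
    vcoord_smul, vcoord_vermaRho c lam hi, vcoord_vermaRho c lam hj, hN, LinearMap.zero_apply,
    vcoord_zero] at h'
  push_cast at h' ⊢
  linear_combination h'

lemma vcoord_vermaRho_zero_pow {p : ℕ} (c lam : K) (hp : 2 ≤ p) (k : ℕ) (x : Fin p → K) (m : ℕ) :
    vcoord ((vermaRho K p c lam 0 ^ k) x) m = (lam - m) ^ k * vcoord x m := by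
  induction k with
  | zero => simp
  | succ k ih =>
    have h := vcoord_vermaRho c lam (j := 0) hp ((vermaRho K p c lam 0 ^ k) x) m
    rw [Nat.cast_zero, wCoef_zero] at h
    rw [pow_succ', Module.End.mul_apply, h, Nat.add_zero, ih, pow_succ']
    ring

lemma oneDimRho_zero_pow (lam' : K) (k : ℕ) : (oneDimRho K lam' 0 ^ k) 1 = lam' ^ k := by
  simp [oneDimRho, smul_pow]

/-- The condition on the `p`-character kills the component of weight `lam'` on `e_0`. -/
lemma vcoord_cocycle_zero {p d : ℕ} [CharP K p] (hp : 2 ≤ p) {c lam lam' : K}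
    (hl : lam' = lam - d) {f : ℤ → K →ₗ[K] (Fin p → K)}
    (hf : f ∈ cocycles K p 0 (vermaRho K p c lam) (oneDimRho K lam')) :
    vcoord (f 0 1) d = 0 := by
  simp only [cocycles, Submodule.mem_inf, Submodule.mem_iInf, LinearMap.mem_ker] at hf
  have h := hf.2 0
  rw [pcharConstraint, if_pos (by omega), if_pos rfl] at h
  have h' := congrArg (fun u => vcoord (u 1) d) h
  simp only [LinearMap.sub_apply, LinearMap.sum_apply, LinearMap.comp_apply,
    LinearMap.proj_apply, LinearMap.llcomp_apply, LinearMap.lcomp_apply, vcoord_sub,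
    vcoord_sum, vcoord_vermaRho_zero_pow c lam hp, LinearMap.zero_apply,
    vcoord_zero, oneDimRho_zero_pow, ← hl] at h'
  have hs : ∀ a : K, vcoord (f 0 a) d = a * vcoord (f 0 1) d := by
    intro a
    rw [← vcoord_smul, ← map_smul, smul_eq_mul, mul_one]
  rw [Finset.sum_congr rfl (g := fun _ => lam' ^ (p - 1) * vcoord (f 0 1) d)] at h'
  · simpa using h'
  · intro k hk
    rw [hs, ← mul_assoc, ← pow_add]
    rw [Finset.mem_range] at hk
    congr 2
    omega

lemma cocycle_eq_zero {p : ℕ} {c lam lam' : K} {f : ℤ → K →ₗ[K] (Fin p → K)}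
    (hf : f ∈ cocycles K p 0 (vermaRho K p c lam) (oneDimRho K lam')) {k : ℤ}
    (hk : k < 0 ∨ (p : ℤ) - 2 < k) : f k = 0 := by
  simp only [cocycles, Submodule.mem_inf, Submodule.mem_iInf, LinearMap.mem_ker] at hf
  have h := hf.1.1 k
  rwa [suppConstraint, if_pos hk] at h

/-- The value on `e_j` of the coboundary of `f`, in coordinates. -/
lemma vcoord_coboundary {p : ℕ} (c lam lam' : K) (f : K →ₗ[K] (Fin p → K)) {j : ℕ}
    (hj : j + 2 ≤ p) (m : ℕ) :
    vcoord ((LinearMap.llcomp K K (Fin p → K) (Fin p → K) (vermaRho K p c lam j)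
        - LinearMap.lcomp K (Fin p → K) (oneDimRho K lam' j) :
          (K →ₗ[K] Fin p → K) →ₗ[K] (K →ₗ[K] Fin p → K)) f 1) m
      = coordCoboundary p lam lam' (vcoord (f 1)) j m := by
  have : oneDimRho K lam' j 1 = (if j = 0 then lam' else 0) • (1 : K) := by
    by_cases hb : j = 0 <;> simp [oneDimRho, hb]
  simp only [LinearMap.sub_apply, LinearMap.llcomp_apply, LinearMap.lcomp_apply, vcoord_sub,
    vcoord_vermaRho c lam hj, this, map_smul, vcoord_smul]
  rw [coordCoboundary, if_pos hj]

lemma mem_coboundaries_iff {p : ℕ} {c lam lam' : K} {f : ℤ → K →ₗ[K] (Fin p → K)}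
    (hf : ∀ k : ℤ, (k < 0 ∨ (p : ℤ) - 2 < k) → f k = 0) :
    f ∈ coboundaries K p 0 (vermaRho K p c lam) (oneDimRho K lam') ↔
      ∃ g : ℕ → K, (∀ m, p ≤ m → g m = 0) ∧
        ∀ j m : ℕ, j + 2 ≤ p → vcoord (f j 1) m = coordCoboundary p lam lam' g j m := by
  rw [coboundaries, LinearMap.mem_range]
  constructor
  · rintro ⟨u, rfl⟩
    refine ⟨vcoord (u 1), fun m => vcoord_of_le _, fun j m hj => ?_⟩
    rw [LinearMap.pi_apply, if_pos (by omega), vcoord_coboundary c lam lam' u hj]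
  · rintro ⟨g, hg, h⟩
    refine ⟨LinearMap.toSpanSingleton K _ fun k : Fin p => g k, ?_⟩
    funext k
    rw [LinearMap.pi_apply]
    split_ifs with hk
    · obtain ⟨j, rfl⟩ := Int.eq_ofNat_of_zero_le hk.1
      apply LinearMap.ext_ring
      refine vcoord_ext fun m => ?_
      rw [vcoord_coboundary c lam lam' _ (by omega), h j m (by omega)]
      congr 1
      funext m
      rw [LinearMap.toSpanSingleton_apply, one_smul, vcoord_restrict g hg]
    · rw [hf k (by omega), LinearMap.zero_apply]

lemma vcoord_pow_eq_zero {p : ℕ} (c lam : K) {j : ℕ} (hj1 : 1 ≤ j) (hj : j + 2 ≤ p)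
    (x : Fin p → K) (d : ℕ) (hx : ∀ m, d ≤ m → vcoord x m = 0) (k m : ℕ) (hk : d ≤ m + k) :
    vcoord ((vermaRho K p c lam j ^ k) x) m = 0 := by
  induction k generalizing m with
  | zero => exact hx m hk
  | succ k ih =>
    rw [pow_succ', Module.End.mul_apply, vcoord_vermaRho c lam hj, ih _ (by omega), mul_zero]

/-- A sequence of scalars satisfying the bracket relations in the weight of the generator
defines a cocycle. -/
lemma exists_cocycle {p d : ℕ} (hdp : d + 2 ≤ p) {c lam lam' : K} (hl : lam' = lam - d)
    (a : ℕ → K) (ha0 : a 0 = 0)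
    (ha : ∀ i j, 1 ≤ i → i < j → i + j ≤ d →
      ((j : K) - i) * a (i + j)
        = wCoef K lam i (d - j) * a j - wCoef K lam j (d - i) * a i) :
    ∃ f ∈ cocycles K p 0 (vermaRho K p c lam) (oneDimRho K lam'),
      ∀ j m : ℕ, vcoord (f j 1) m = if j + m = d then a j else 0 := by
  set f : ℤ → K →ₗ[K] (Fin p → K) := fun k => if 0 ≤ k then
    LinearMap.toSpanSingleton K _ fun m : Fin p => if k.toNat + m = d then a k.toNat else 0
    else 0 with hfdef
  have hf : ∀ j m : ℕ, vcoord (f j 1) m = if j + m = d then a j else 0 := by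
    intro j m
    have : f j 1 = fun m : Fin p => (fun m : ℕ => if j + m = d then a j else 0) m := by
      simp [hfdef]
    rw [this, vcoord_restrict fun m => if j + m = d then a j else 0]
    intro m hm
    exact if_neg (by omega)
  have hsymm : ∀ i j, 1 ≤ i → 1 ≤ j → i + j ≤ d →
      ((j : K) - i) * a (i + j)
        = wCoef K lam i (d - j) * a j - wCoef K lam j (d - i) * a i := by
    intro i j hi hj hij
    rcases lt_trichotomy i j with h | rfl | h
    · exact ha i j hi h hij
    · ring
    · have := ha j i hj h (by omega)
      rw [add_comm j i] at this
      linear_combination -this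
  have hN : ∀ (a b : ℕ) m, vcoord (f a (oneDimRho K lam' b 1)) m
      = (if b = 0 then lam' else 0) * vcoord (f a 1) m := by
    intro a b m
    have : oneDimRho K lam' b 1 = (if b = 0 then lam' else 0) • (1 : K) := by
      by_cases hb : b = 0 <;> simp [oneDimRho, hb]
    rw [this, map_smul, vcoord_smul]
  refine ⟨f, ?_, hf⟩
  simp only [cocycles, Submodule.mem_inf, Submodule.mem_iInf, LinearMap.mem_ker]
  refine ⟨⟨fun k => ?_, fun i j => ?_⟩, fun i => ?_⟩
  · unfold suppConstraint
    split_ifs with hk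
    · rw [LinearMap.proj_apply]
      rcases lt_or_ge k 0 with h | h
      · simp [hfdef, not_le.2 h]
      · obtain ⟨j, rfl⟩ := Int.eq_ofNat_of_zero_le h
        apply LinearMap.ext_ring
        refine vcoord_ext fun m => ?_
        rw [hf, if_neg (by omega), LinearMap.zero_apply, vcoord_zero]
    · simp
  · unfold bracketConstraint
    split_ifs with hij
    · obtain ⟨i, rfl⟩ := Int.eq_ofNat_of_zero_le hij.1
      obtain ⟨j, rfl⟩ := Int.eq_ofNat_of_zero_le hij.2.2.1
      have hi : i + 2 ≤ p := by omega
      have hj : j + 2 ≤ p := by omega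
      apply LinearMap.ext_ring
      refine vcoord_ext fun m => ?_
      simp only [LinearMap.add_apply, LinearMap.sub_apply, LinearMap.smul_apply,
        LinearMap.comp_apply, LinearMap.proj_apply, LinearMap.llcomp_apply,
        LinearMap.lcomp_apply, vcoord_add, vcoord_sub,
        vcoord_smul, vcoord_vermaRho c lam hi, vcoord_vermaRho c lam hj, hN,
        LinearMap.zero_apply, vcoord_zero, ← Nat.cast_add, hf]
      by_cases hd : i + j + m = d
      · rw [if_pos hd, if_pos (show j + (m + i) = d by omega),
          if_pos (show i + (m + j) = d by omega)]
        have hdK : (d : K) = i + j + m := by rw [← hd]; push_cast; ring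
        rcases Nat.eq_zero_or_pos i with rfl | hi0
        · rcases Nat.eq_zero_or_pos j with rfl | hj0
          · simp [ha0]
          · simp only [ha0, wCoef_zero, if_true, hj0.ne', if_false, Nat.zero_add, Nat.add_zero,
              if_pos (show j + m = d by omega)]
            rw [hl, hdK]
            push_cast
            simp
            ring
        · rcases Nat.eq_zero_or_pos j with rfl | hj0
          · simp only [ha0, wCoef_zero, if_true, hi0.ne', if_false, Nat.zero_add, Nat.add_zero,
              if_pos (show i + m = d by omega)]
            rw [hl, hdK]
            push_cast
            simp
            ring
          · have := hsymm i j hi0 hj0 (by omega)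
            rw [show d - j = m + i by omega, show d - i = m + j by omega] at this
            simp only [hi0.ne', hj0.ne', if_false]
            push_cast
            linear_combination this
      · rw [if_neg hd, if_neg (show ¬ j + (m + i) = d by omega),
          if_neg (show ¬ i + (m + j) = d by omega)]
        rcases Nat.eq_zero_or_pos i with rfl | hi0
        · rw [if_neg (show ¬ j + m = d by omega)]
          simp [ha0]
        · rcases Nat.eq_zero_or_pos j with rfl | hj0
          · rw [if_neg (show ¬ i + m = d by omega)]
            simp [ha0]
          · simp [hi0.ne', hj0.ne']
    · simp
  · unfold pcharConstraint
    split_ifs with hi h0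
    · subst h0
      have hf0 : f 0 = 0 := by
        apply LinearMap.ext_ring
        refine vcoord_ext fun m => ?_
        have := hf 0 m
        rw [ha0, ite_self] at this
        simpa using this
      simp [LinearMap.sum_apply, hf0]
    · obtain ⟨i, rfl⟩ := Int.eq_ofNat_of_zero_le hi.1
      have hi0 : 1 ≤ i := by omega
      have hN0 : oneDimRho K lam' i = 0 := by
        simp [oneDimRho, show i ≠ 0 by omega]
      apply LinearMap.ext_ring
      refine vcoord_ext fun m => ?_
      simp only [LinearMap.sub_apply, LinearMap.sum_apply, LinearMap.comp_apply,
        LinearMap.proj_apply, LinearMap.llcomp_apply, LinearMap.lcomp_apply,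
        vcoord_sum, LinearMap.zero_apply, vcoord_zero, sub_zero]
      refine Finset.sum_eq_zero fun k hk => ?_
      rw [Finset.mem_range] at hk
      by_cases hkp : p - 1 - k = 0
      · rw [hkp, pow_zero, Module.End.one_apply]
        refine vcoord_pow_eq_zero c lam hi0 (by omega) _ d (fun m hm => ?_) _ _ (by omega)
        rw [hf, if_neg (by omega)]
      · rw [hN0, zero_pow hkp]
        simp
    · simp

/-- In the exceptional cases there is a cocycle which does not vanish on `e_1`. -/
lemma exists_cocycle_exceptional {p d : ℕ} [CharP K p] (hp : 3 < p) (hdp : d + 2 ≤ p)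
    (hex : (d = 2 ∨ d = 3 ∨ d = 4) ∨ (d = 6 ∧ p = 19)) {c lam lam' : K}
    (h2 : 2 * lam = d - 1) (hl : lam' = lam - d) :
    ∃ f ∈ cocycles K p 0 (vermaRho K p c lam) (oneDimRho K lam'),
      vcoord (f 1 1) (d - 1) = 1 := by
  have htwo : (2 : K) ≠ 0 := by
    exact_mod_cast natCast_ne_zero_of_lt (K := K) (p := p) (a := 2) (by omega) (by omega)
  obtain ⟨a3, ha3⟩ : ∃ a3 : K, a3 = -wCoef K lam 2 (d - 1) := ⟨_, rfl⟩
  obtain ⟨a4, h4⟩ : ∃ a4 : K,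
      2 * a4 = wCoef K lam 1 (d - 3) * a3 - wCoef K lam 3 (d - 1) :=
    ⟨_, mul_div_cancel₀ _ htwo⟩
  obtain ⟨a5, ha5⟩ : ∃ a5 : K, a5 = wCoef K lam 2 (d - 3) * a3 := ⟨_, rfl⟩
  obtain ⟨a6, h6⟩ : ∃ a6 : K, 2 * a6 = wCoef K lam 2 (d - 4) * a4 :=
    ⟨_, mul_div_cancel₀ _ htwo⟩
  set a : ℕ → K := fun j => match j with
    | 1 => 1
    | 3 => a3
    | 4 => a4
    | 5 => a5
    | 6 => a6
    | _ => 0 with hadef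
  obtain ⟨f, hf, hfa⟩ := exists_cocycle (c := c) hdp hl a rfl (by
    intro i j hi hij hijd
    have hd6 : d ≤ 6 := by omega
    obtain (⟨rfl, rfl⟩ | ⟨rfl, rfl⟩ | ⟨rfl, rfl⟩ | ⟨rfl, rfl⟩ | ⟨rfl, rfl, rfl, rfl⟩ |
        ⟨rfl, rfl, rfl, rfl⟩) :
        (i = 1 ∧ j = 2) ∨ (i = 1 ∧ j = 3) ∨ (i = 2 ∧ j = 3) ∨ (i = 2 ∧ j = 4) ∨
        (d = 6 ∧ p = 19 ∧ i = 1 ∧ j = 4) ∨ (d = 6 ∧ p = 19 ∧ i = 1 ∧ j = 5) := by omega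
    · simp only [hadef]
      push_cast
      linear_combination ha3
    · simp only [hadef]
      push_cast
      linear_combination h4
    · simp only [hadef]
      push_cast
      linear_combination ha5
    · simp only [hadef]
      push_cast
      linear_combination h6
    all_goals
      have h19 : (19 : K) = 0 := by exact_mod_cast CharP.cast_eq_zero K 19
      obtain rfl : lam = 12 := by
        apply mul_left_cancel₀ htwo
        push_cast at h2
        linear_combination h2 - h19
      simp only [hadef]
      simp only [wCoef, Nat.reduceSub, Nat.descFactorial_succ, Nat.descFactorial_zero] at *
      norm_num at ha3 ha5 h4 h6 ⊢
      have e4 : a4 = -1 := by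
        apply mul_left_cancel₀ htwo
        linear_combination h4 - 66 * ha3 + 2438 * h19
    · linear_combination 3 * ha5 + 630 * ha3 + 46 * e4 - 21514 * h19
    · linear_combination 2 * h6 + 144 * e4 + 24 * ha5 + 5040 * ha3 - 175536 * h19)
  refine ⟨f, hf, ?_⟩
  have := hfa 1 (d - 1)
  rw [if_pos (by omega)] at this
  exact_mod_cast this

/-- A cocycle is a coboundary if and only if its component of weight `lam' + 1` on `e_1`
vanishes. -/
lemma cocycle_mem_coboundaries_iff {p d : ℕ} [CharP K p] (hp : 3 < p) (hd2 : 2 ≤ d)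
    (hdp : d + 2 ≤ p) {c lam lam' : K} (h2 : 2 * lam = d - 1) (hl : lam' = lam - d)
    {f : ℤ → K →ₗ[K] (Fin p → K)}
    (hf : f ∈ cocycles K p 0 (vermaRho K p c lam) (oneDimRho K lam')) :
    f ∈ coboundaries K p 0 (vermaRho K p c lam) (oneDimRho K lam') ↔
      vcoord (f 1 1) (d - 1) = 0 := by
  have hw : ∀ g : ℕ → K, coordCoboundary p lam lam' g 1 (d - 1) = 0 := by
    intro g
    have hw1 : wCoef K lam 1 d = 0 := by
      simp only [wCoef]
      push_cast
      linear_combination (-(d.descFactorial 1 : K)) * h2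
    rw [coordCoboundary, if_pos (by omega), Nat.sub_add_cancel (by omega), hw1]
    simp
  rw [mem_coboundaries_iff fun k => cocycle_eq_zero hf]
  constructor
  · rintro ⟨g, -, h⟩
    have := h 1 (d - 1) (by omega)
    rw [hw] at this
    exact_mod_cast this
  · intro h1
    have hy := vcoord_cocycle hf
    obtain ⟨g, hg, z0, z2, z1⟩ := exists_normalized hp hd2 hdp h2 hl hy
      (fun j m hm => vcoord_of_le _ hm) (by exact_mod_cast vcoord_cocycle_zero (by omega) hl hf)
    refine ⟨g, hg, fun j m hj => sub_eq_zero.1 ?_⟩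
    refine (hy.sub (isCoordCocycle_coboundary lam lam' g hg)).eq_zero z0 (fun m => ?_) z2 j hj m
    by_cases hm : m = d - 1
    · rw [hm, Pi.sub_apply, Pi.sub_apply, hw, sub_zero]
      exact_mod_cast h1
    · exact z1 m hm

/-- Away from the exceptional cases every cocycle is a coboundary. -/
lemma vcoord_cocycle_one_eq_zero {p d : ℕ} [CharP K p] (hpp : p.Prime) (hd5 : 5 ≤ d)
    (hdp : d + 2 ≤ p) (hex : ¬(d = 6 ∧ p = 19)) {c lam lam' : K} (h2 : 2 * lam = d - 1)
    (hl : lam' = lam - d) {f : ℤ → K →ₗ[K] (Fin p → K)}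
    (hf : f ∈ cocycles K p 0 (vermaRho K p c lam) (oneDimRho K lam')) :
    vcoord (f 1 1) (d - 1) = 0 := by
  have hy := vcoord_cocycle hf
  obtain ⟨g, hg, -, z2, -⟩ := exists_normalized (by omega) (by omega) hdp h2 hl hy
    (fun j m hm => vcoord_of_le _ hm) (by exact_mod_cast vcoord_cocycle_zero (by omega) hl hf)
  have h := obstruction hpp hd5 hdp hex h2
    (hy.sub (isCoordCocycle_coboundary lam lam' g hg)) z2
  have hw1 : wCoef K lam 1 d = 0 := by
    simp only [wCoef]
    push_cast
    linear_combination (-(d.descFactorial 1 : K)) * h2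
  rw [Pi.sub_apply, Pi.sub_apply, coordCoboundary, if_pos (by omega),
    Nat.sub_add_cancel (by omega), hw1] at h
  simpa using h

/-- The component of weight `lam' + 1` on `e_1` of a cocycle. -/
def cocycleCoord (p d : ℕ) (hd : d - 1 < p) (c lam lam' : K) :
    cocycles K p 0 (vermaRho K p c lam) (oneDimRho K lam') →ₗ[K] K where
  toFun f := (f : ℤ → K →ₗ[K] (Fin p → K)) 1 1 ⟨d - 1, hd⟩
  map_add' _ _ := rfl
  map_smul' _ _ := rfl

end WittExt

open scoped Classical in
/-- If `χ` has height `-1`, `0` or `1`, `λ, λ' ∈ Λ(χ)`, `(λ, λ') ∉ Θ(χ)` and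
`λ + λ' = p-1`, then, over `W_0`, `Ext(K_{λ'}, V_χ(λ)) ≅ K` if `[λ-λ'] ∈ {2,3,4}`,
or `[λ-λ'] = 6` and `p = 19`; and `Ext(K_{λ'}, V_χ(λ)) = 0` otherwise. -/
theorem ext_Klambda'_verma_sum_pm1
    (K : Type) [Field K] [IsAlgClosed K] (p : ℕ) [CharP K p] (hp : 3 < p)
    (chi : ℤ → K) (hsupp : ∀ k : ℤ, (k < -1 ∨ (p : ℤ) - 2 < k) → chi k = 0)
    (hheight : ∀ k : ℤ, 1 ≤ k → chi k = 0)
    (lam lam' : K)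
    (hlam : lam ^ p - lam = chi 0 ^ p) (hlam' : lam' ^ p - lam' = chi 0 ^ p)
    (hne : lam ≠ lam')
    (hTheta1 : ¬(lam = 0 ∧ lam' = (p : K) - 1)) (hTheta2 : ¬(lam = (p : K) - 1 ∧ lam' = 0))
    (hsum : lam + lam' = (p : K) - 1)
    (d : ℕ) (hd : d < p) (hdval : (d : K) = lam - lam') :
    Module.finrank K (extSpace K p 0
        (vermaRho K p (chi (-1) ^ p) lam) (oneDimRho K lam'))
      = if (d = 2 ∨ d = 3 ∨ d = 4) ∨ (d = 6 ∧ p = 19) then 1 else 0 := by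
  have hpp : p.Prime := (CharP.char_is_prime_or_zero K p).resolve_right (by omega)
  have hp0 : (p : K) = 0 := CharP.cast_eq_zero K p
  have htwo : (2 : K) ≠ 0 := by
    exact_mod_cast natCast_ne_zero_of_lt (K := K) (p := p) (a := 2) (by omega) (by omega)
  have h2 : 2 * lam = d - 1 := by linear_combination hsum - hdval + hp0
  have hl : lam' = lam - d := by linear_combination hdval
  have hd2 : 2 ≤ d := by
    by_contra h
    obtain rfl | rfl : d = 0 ∨ d = 1 := by omega
    · exact hne (by linear_combination -hl - Nat.cast_zero (R := K))
    · have h0 : lam = 0 := (mul_eq_zero.1 (by rw [h2]; simp)).resolve_left htwo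
      exact hTheta1 ⟨h0, by linear_combination hsum - h0⟩
  have hdp : d + 2 ≤ p := by
    by_contra h
    have hd1 : (d : K) + 1 = 0 := by
      rw [← hp0, ← show d + 1 = p by omega]
      push_cast
      ring
    have h0 : lam' = 0 := mul_left_cancel₀ htwo (by linear_combination 2 * hl + h2 - hd1)
    exact hTheta2 ⟨by linear_combination hsum - h0, h0⟩
  have hd1p : d - 1 < p := by omega
  set φ := cocycleCoord p d hd1p (chi (-1) ^ p) lam lam'
  have hφv : ∀ f, φ f = vcoord ((f : ℤ → K →ₗ[K] (Fin p → K)) 1 1) (d - 1) := fun f =>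
    (vcoord_apply _ (⟨d - 1, hd1p⟩ : Fin p)).symm
  have hker : Submodule.comap
      (cocycles K p 0 (vermaRho K p (chi (-1) ^ p) lam) (oneDimRho K lam')).subtype
      (coboundaries K p 0 (vermaRho K p (chi (-1) ^ p) lam) (oneDimRho K lam'))
      = LinearMap.ker φ := by
    ext f
    rw [Submodule.mem_comap, LinearMap.mem_ker, hφv, Submodule.subtype_apply,
      cocycle_mem_coboundaries_iff hp hd2 hdp h2 hl f.2]
  refine ((Submodule.quotEquivOfEq _ _ hker).trans φ.quotKerEquivRange).finrank_eq.trans ?_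
  split_ifs with hex
  · obtain ⟨f, hf, hf1⟩ := exists_cocycle_exceptional (c := chi (-1) ^ p) hp hdp hex h2 hl
    have hsurj : LinearMap.range φ = ⊤ := by
      rw [LinearMap.range_eq_top]
      intro a
      refine ⟨a • ⟨f, hf⟩, ?_⟩
      rw [map_smul, hφv, hf1, smul_eq_mul, mul_one]
    rw [hsurj, finrank_top, Module.finrank_self]
  · have hzero : φ = 0 := by
      ext f
      rw [hφv]
      exact vcoord_cocycle_one_eq_zero hpp (by omega) hdp (by tauto) h2 hl f.2
    rw [hzero, LinearMap.range_zero, finrank_bot]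
end

section
/- Let χ be a linear functional on W of height -1, 0 or 1, let λ, λ' ∈ Λ(χ), and let a = (a_1, ..., a_{p-2}) ∈ K^{p-2}. Assume the space M_a carries a W_0-module structure in which each e_j (0 ≤ j ≤ p-2) acts as the endomorphism E_j. Then M_a has p-character χ if and only if the following implication holds: if λ = λ' and either r(χ) = 1 or 2λ = p-1, then a_1 = 0. (In particular, if λ ≠ λ', or if r(χ) ∈ {-1, 0} and 2λ ≠ p-1, then M_a automatically has p-character χ.) -/
/-!
Common setup: the Witt algebra `W` over `K` (char `p > 3`) has basis
`e_{-1}, e_0, ..., e_{p-2}` with `[e_i, e_j] = (j-i) e_{i+j}` (and `e_k = 0`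
outside the range), and `p`-mapping `e_i^{[p]} = δ_{i0} e_i`.  A module with
`p`-character `χ` over `W` (resp. the subalgebra `W_0 = <e_0, ..., e_{p-2}>`)
is given by a family of endomorphisms `ρ k` (`k : ℤ`, vanishing outside
`[lo, p-2]` where `lo = -1` for `W` and `lo = 0` for `W_0`) satisfying the
bracket relations and `(ρ i)^p - δ_{i0} ρ i = χ(e_i)^p • 1`.

The Baer Ext space `Ext(N, M)` of two such modules, in the category of
modules with `p`-character `χ`, is realized concretely: an extension
`0 → M → E → N → 0` admits a linear splitting `E ≃ M ⊕ N`, under which the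
action of `e_k` is `(m, n) ↦ (ρM k m + c k n, ρN k n)` for a "cocycle"
`c : ℤ → (N →ₗ M)`; the conditions for `E` to be a module with `p`-character
`χ` are the cocycle conditions below, Baer equivalence corresponds to
differing by a coboundary, and the Baer sum / scalar action correspond to the
linear structure on cocycles.  So `Ext(N, M) ≅ cocycles / coboundaries`.
-/

set_option maxHeartbeats 1000000
set_option synthInstance.maxHeartbeats 1000000

/-- Matrices (in the basis `w_0, ..., w_{p-1}, w'`, with `w'` in position `p`)
of the endomorphisms `E_j` (`0 ≤ j ≤ p-2`) of the space `M_a`: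
`E_j w_i = (-1)^j (i!/(i-j)!) ((j+1)λ - i + j) w_{i-j}` for `j ≤ i`, `E_j w_i = 0`
for `j > i`, `E_0 w' = λ' w'`, and `E_j w' = a_j w_{[λ-λ'-j]}` for `1 ≤ j ≤ p-2`,
where `d = [λ-λ']`, so `[λ-λ'-j] = (d + (p - j)) % p`. -/
noncomputable def maMat (K : Type) [Field K] (p : ℕ) (lam lam' : K) (d : ℕ) (a : ℕ → K) :
    ℤ → Matrix (Fin (p + 1)) (Fin (p + 1)) K := fun j =>
  if 0 ≤ j ∧ j ≤ (p : ℤ) - 2 then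
    Matrix.of fun k l =>
      if (k : ℕ) < p ∧ (l : ℕ) < p then
        (if (l : ℕ) = (k : ℕ) + j.toNat then wCoef K lam j.toNat (l : ℕ) else 0)
      else if (k : ℕ) = p ∧ (l : ℕ) = p then (if j = 0 then lam' else 0)
      else if (l : ℕ) = p ∧ 1 ≤ j ∧ (k : ℕ) = (d + (p - j.toNat)) % p then a j.toNat
      else 0
  else 0

/-- The endomorphisms `E_j` of `M_a` (zero outside `0 ≤ j ≤ p-2`). -/
noncomputable def maRho (K : Type) [Field K] (p : ℕ) (lam lam' : K) (d : ℕ) (a : ℕ → K) :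
    ℤ → Module.End K (Fin (p + 1) → K) := fun j => Matrix.toLin' (maMat K p lam lam' d a j)

theorem wCoef_of_lt (K : Type) [Field K] (lam : K) {j i : ℕ} (h : i < j) :
    wCoef K lam j i = 0 := by
  simp [wCoef, Nat.descFactorial_of_lt h]

theorem wCoef_one_eq (K : Type) [Field K] (lam : K) (i : ℕ) :
    wCoef K lam 1 i = -((i : K) * (2 * lam + 1 - i)) := by
  simp only [wCoef, Nat.descFactorial_one]
  push_cast
  ring

theorem prod_wCoef_eq_zero (K : Type) [Field K] (lam : K) {j n l : ℕ} (hn : 0 < n)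
    (h : l < n * j) : ∏ t ∈ Finset.range n, wCoef K lam j (l - t * j) = 0 := by
  refine Finset.prod_eq_zero (i := n - 1) (by simp; omega) (wCoef_of_lt K lam ?_)
  obtain ⟨m, rfl⟩ : ∃ m, n = m + 1 := ⟨n - 1, by omega⟩
  rw [add_mul, one_mul] at h
  have : 0 < j := by
    rcases Nat.eq_zero_or_pos j with rfl | hj
    · simp at h
    · exact hj
  simp only [Nat.add_sub_cancel]
  omega

/-- The basis vectors `w_0, ..., w_{p-1}, w'` of `M_a`, indexed by natural numbers. -/
def maBasis (K : Type) [Field K] (p n : ℕ) : Fin (p + 1) → K :=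
  fun k => if (k : ℕ) = n then 1 else 0

theorem maBasis_eq_single (K : Type) [Field K] (p : ℕ) (l : Fin (p + 1)) :
    maBasis K p l = Pi.single l 1 := by
  ext k
  simp [maBasis, Pi.single_apply, Fin.ext_iff]

theorem maBasis_ne_zero (K : Type) [Field K] {p n : ℕ} (h : n ≤ p) : maBasis K p n ≠ 0 := by
  intro h0
  have := congrFun h0 ⟨n, by omega⟩
  simp [maBasis] at this

theorem ext_maBasis {K : Type} [Field K] {p : ℕ} {S T : Module.End K (Fin (p + 1) → K)}
    (h : ∀ l < p, S (maBasis K p l) = T (maBasis K p l))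
    (h' : S (maBasis K p p) = T (maBasis K p p)) : S = T := by
  refine (Pi.basisFun K (Fin (p + 1))).ext fun l => ?_
  rw [Pi.basisFun_apply, ← maBasis_eq_single]
  rcases lt_or_eq_of_le (Nat.lt_succ_iff.mp l.2) with hl | hl
  · exact h _ hl
  · rw [hl]
    exact h'

section

variable (K : Type) [Field K] (p : ℕ) (lam lam' : K) (d : ℕ) (a : ℕ → K)

theorem maRho_apply_maBasis (j : ℤ) {l : ℕ} (hl : l ≤ p) (k : Fin (p + 1)) :
    maRho K p lam lam' d a j (maBasis K p l) k =
      maMat K p lam lam' d a j k ⟨l, Nat.lt_succ_of_le hl⟩ := by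
  have : maBasis K p l = Pi.single ⟨l, Nat.lt_succ_of_le hl⟩ 1 :=
    maBasis_eq_single K p ⟨l, Nat.lt_succ_of_le hl⟩
  rw [this, maRho, Matrix.toLin'_apply, Matrix.mulVec_single_one, Matrix.col_apply]

theorem maRho_natCast_maBasis_of_lt {j l : ℕ} (hj : (j : ℤ) ≤ (p : ℤ) - 2) (hl : l < p) :
    maRho K p lam lam' d a j (maBasis K p l) = wCoef K lam j l • maBasis K p (l - j) := by
  ext k
  rw [maRho_apply_maBasis K p lam lam' d a j hl.le]
  have hk := k.2
  simp only [maMat, maBasis, Pi.smul_apply, smul_eq_mul]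
  rw [if_pos ⟨by omega, hj⟩]
  simp only [Matrix.of_apply, hl, and_true, hl.ne, and_false, false_and, if_false, Int.toNat_natCast]
  by_cases h : l < j
  · rw [wCoef_of_lt K lam h]
    simp
  · split_ifs <;> first | omega | simp

theorem maRho_zero_maBasis_last (hp : 2 ≤ p) :
    maRho K p lam lam' d a 0 (maBasis K p p) = lam' • maBasis K p p := by
  ext k
  rw [maRho_apply_maBasis K p lam lam' d a 0 le_rfl]
  simp only [maMat, maBasis, Pi.smul_apply, smul_eq_mul]
  rw [if_pos ⟨le_rfl, by omega⟩]
  simp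

theorem maRho_natCast_maBasis_last {j : ℕ} (hj1 : 1 ≤ j) (hj : (j : ℤ) ≤ (p : ℤ) - 2) :
    maRho K p lam lam' d a j (maBasis K p p) = a j • maBasis K p ((d + (p - j)) % p) := by
  ext k
  rw [maRho_apply_maBasis K p lam lam' d a j le_rfl]
  have hk := k.2
  have hm : (d + (p - j)) % p < p := Nat.mod_lt _ (by omega)
  simp only [maMat, maBasis, Pi.smul_apply, smul_eq_mul]
  rw [if_pos ⟨by omega, hj⟩]
  have h1 : (1 : ℤ) ≤ j := by omega
  have h0 : (j : ℤ) ≠ 0 := by omega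
  simp only [Matrix.of_apply, lt_irrefl, and_false, if_false, and_true, h0, h1, true_and,
    Int.toNat_natCast]
  split_ifs <;> first | omega | simp

theorem maRho_pow_maBasis {j : ℕ} (hj : (j : ℤ) ≤ (p : ℤ) - 2) (n : ℕ) {l : ℕ} (hl : l < p) :
    (maRho K p lam lam' d a j ^ n) (maBasis K p l) =
      (∏ t ∈ Finset.range n, wCoef K lam j (l - t * j)) • maBasis K p (l - n * j) := by
  induction n with
  | zero => simp
  | succ n ih =>
    rw [pow_succ', Module.End.mul_apply, ih, map_smul,
      maRho_natCast_maBasis_of_lt K p lam lam' d a hj (by omega), smul_smul,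
      Finset.prod_range_succ, Nat.sub_sub, add_mul, one_mul]

theorem maRho_pow_maBasis_last {j : ℕ} (hj1 : 1 ≤ j) (hj : (j : ℤ) ≤ (p : ℤ) - 2) :
    (maRho K p lam lam' d a j ^ p) (maBasis K p p) =
      (a j * ∏ t ∈ Finset.range (p - 1), wCoef K lam j ((d + (p - j)) % p - t * j)) •
        maBasis K p ((d + (p - j)) % p - (p - 1) * j) := by
  have hm : (d + (p - j)) % p < p := Nat.mod_lt _ (by omega)
  rw [← pow_sub_one_mul (show p ≠ 0 by omega), Module.End.mul_apply,
    maRho_natCast_maBasis_last K p lam lam' d a hj1 hj, map_smul,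
    maRho_pow_maBasis K p lam lam' d a hj _ hm, smul_smul]

/-- Unless `j = 1` and `λ = λ'`, the `p`-th power of `E_j` kills `w'`. -/
theorem prod_wCoef_last_eq_zero {j : ℕ} (hp : 3 < p) (hd : d < p) (hj1 : 1 ≤ j)
    (hj : (j : ℤ) ≤ (p : ℤ) - 2) (h : j = 1 → d ≠ 0) :
    ∏ t ∈ Finset.range (p - 1), wCoef K lam j ((d + (p - j)) % p - t * j) = 0 := by
  refine prod_wCoef_eq_zero K lam (by omega) ?_
  have hm : (d + (p - j)) % p < p := Nat.mod_lt _ (by omega)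
  by_cases h1 : j = 1
  · subst h1
    have hd0 := h rfl
    have : (d + (p - 1)) % p = d - 1 := by
      rw [show d + (p - 1) = d - 1 + p by omega, Nat.add_mod_right, Nat.mod_eq_of_lt (by omega)]
    omega
  · have : (p - 1) * 2 ≤ (p - 1) * j := Nat.mul_le_mul_left _ (by omega)
    omega

end

theorem natCast_pow_char (K : Type) [Field K] (p : ℕ) [Fact p.Prime] [CharP K p] (n : ℕ) :
    (n : K) ^ p = n := by
  rw [← frobenius_def, map_natCast]

theorem exists_natCast_eq_of_pow_char_eq {K : Type} [Field K] {p : ℕ} [Fact p.Prime] [CharP K p]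
    {y : K} (h : y ^ p = y) : ∃ n < p, (n : K) = y := by
  obtain ⟨z, rfl⟩ : y ∈ (ZMod.castHom dvd_rfl K : ZMod p →+* K).fieldRange := by
    rw [ZMod.fieldRange_castHom_eq_bot, Subfield.mem_bot_iff_pow_eq_self]
    exact h
  refine ⟨z.val, z.val_lt, ?_⟩
  rw [← map_natCast (ZMod.castHom dvd_rfl K : ZMod p →+* K), ZMod.natCast_zmod_val]

/-- If `λ^p - λ = c^p`, then `∏_{i=1}^{p-1} (2λ + 1 - i)` vanishes exactly when `c = 0` and
`2λ ≠ -1`. -/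
theorem prod_wCoef_one_eq_zero_iff {K : Type} [Field K] {p : ℕ} [Fact p.Prime] [CharP K p]
    (hp : 3 < p) {lam c : K} (hlam : lam ^ p - lam = c ^ p) :
    ∏ t ∈ Finset.range (p - 1), wCoef K lam 1 (p - 1 - t) = 0 ↔ c = 0 ∧ 2 * lam ≠ -1 := by
  have hp0 : p ≠ 0 := by omega
  have hcast : ∀ n : ℕ, 0 < n → n < p → (n : K) ≠ 0 := fun n h0 hn h =>
    absurd (Nat.le_of_dvd h0 ((CharP.cast_eq_zero_iff K p n).mp h)) (by omega)
  have h2 : (2 : K) ≠ 0 := by exact_mod_cast hcast 2 (by omega) (by omega)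
  have hy : (2 * lam + 1) ^ p - (2 * lam + 1) = 2 * c ^ p := by
    have h2p := natCast_pow_char K p 2
    push_cast at h2p
    rw [add_pow_char, mul_pow, h2p, one_pow, ← hlam]
    ring
  rw [Finset.prod_eq_zero_iff]
  constructor
  · rintro ⟨t, ht, h⟩
    rw [Finset.mem_range] at ht
    have hi := hcast (p - 1 - t) (by omega) (by omega)
    rw [wCoef_one_eq, neg_eq_zero, mul_eq_zero, or_iff_right hi, sub_eq_zero] at h
    rw [h, natCast_pow_char, sub_self, eq_comm, mul_eq_zero, or_iff_right h2] at hy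
    refine ⟨eq_zero_of_pow_eq_zero hy, fun h' => hi ?_⟩
    rw [← h, h']
    ring
  · rintro ⟨rfl, h⟩
    rw [zero_pow hp0, mul_zero, sub_eq_zero] at hy
    obtain ⟨n, hn, hny⟩ := exists_natCast_eq_of_pow_char_eq hy
    have hn0 : n ≠ 0 := by
      rintro rfl
      apply h
      rw [eq_neg_iff_add_eq_zero, ← hny, Nat.cast_zero]
    refine ⟨p - 1 - n, Finset.mem_range.mpr (by omega), ?_⟩
    rw [wCoef_one_eq, show p - 1 - (p - 1 - n) = n by omega, hny, sub_self, mul_zero, neg_zero]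

/-- Suppose `χ` has height `-1`, `0` or `1`, `λ, λ' ∈ Λ(χ)`, and the space `M_a`
carries a `W_0`-module structure in which each `e_j` acts as `E_j`.  Then `M_a`
has `p`-character `χ` if and only if: if `λ = λ'` and (`r(χ) = 1` or `2λ = p-1`)
then `a_1 = 0`.  (Given that `χ` has height at most `1`, `r(χ) = 1` means `χ(e_0) ≠ 0`.) -/
theorem ma_has_pCharacter_iff
    (K : Type) [Field K] [IsAlgClosed K] (p : ℕ) [CharP K p] (hp : 3 < p)
    (chi : ℤ → K) (hsupp : ∀ k : ℤ, (k < -1 ∨ (p : ℤ) - 2 < k) → chi k = 0)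
    (hheight : ∀ k : ℤ, 1 ≤ k → chi k = 0)
    (lam lam' : K)
    (hlam : lam ^ p - lam = chi 0 ^ p) (hlam' : lam' ^ p - lam' = chi 0 ^ p)
    (d : ℕ) (hd : d < p) (hdval : (d : K) = lam - lam')
    (a : ℕ → K)
    (hmod : ∀ i j : ℤ, 0 ≤ i → i ≤ (p : ℤ) - 2 → 0 ≤ j → j ≤ (p : ℤ) - 2 →
      maRho K p lam lam' d a i * maRho K p lam lam' d a j -
          maRho K p lam lam' d a j * maRho K p lam lam' d a i =
        ((j - i : ℤ) : K) • maRho K p lam lam' d a (i + j)) :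
    (∀ i : ℤ, 0 ≤ i → i ≤ (p : ℤ) - 2 →
        (maRho K p lam lam' d a i) ^ p =
          (if i = 0 then maRho K p lam lam' d a 0 else 0) + chi i ^ p • 1)
      ↔ ((lam = lam' ∧ (chi 0 ≠ 0 ∨ 2 * lam = (p : K) - 1)) → a 1 = 0) := by
  have : Fact p.Prime := ⟨(CharP.char_is_prime_or_zero K p).resolve_right (by omega)⟩
  have hd0 : d = 0 ↔ lam = lam' := by
    rw [← sub_eq_zero (a := lam), ← hdval, CharP.cast_eq_zero_iff K p]
    exact ⟨fun h => h ▸ dvd_zero p, fun h => Nat.eq_zero_of_dvd_of_lt h hd⟩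
  have hprod := prod_wCoef_one_eq_zero_iff hp hlam
  have hlast : lam = lam' → (d + (p - 1)) % p = p - 1 := fun h => by
    rw [hd0.mpr h, zero_add, Nat.mod_eq_of_lt (by omega)]
  rw [CharP.cast_eq_zero K p, zero_sub]
  constructor
  · rintro h ⟨hll, hor⟩
    have h1 := congrArg (fun T => T (maBasis K p p)) (h 1 (by omega) (by omega))
    have key := maRho_pow_maBasis_last K p lam lam' d a le_rfl (j := 1) (by omega)
    rw [Nat.cast_one] at key
    simp only [key, hheight 1 le_rfl, hlast hll, mul_one, one_ne_zero, if_false,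
      zero_pow (show p ≠ 0 by omega), zero_smul, add_zero, LinearMap.zero_apply] at h1
    rw [smul_eq_zero, or_iff_left (maBasis_ne_zero K (by omega)), mul_eq_zero, hprod] at h1
    tauto
  · intro h i hi hip
    obtain ⟨j, rfl⟩ := Int.eq_ofNat_of_zero_le hi
    rcases Nat.eq_zero_or_pos j with rfl | hj
    · refine ext_maBasis (fun l hl => ?_) ?_
      · rw [maRho_pow_maBasis K p lam lam' d a hip p hl]
        have hT := maRho_natCast_maBasis_of_lt K p lam lam' d a hip hl
        have hl' : (lam - l) ^ p = lam - l + chi 0 ^ p := by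
          rw [sub_pow_char, natCast_pow_char, ← hlam]
          ring
        simp only [Nat.cast_zero] at hT
        simp [hT, wCoef, hl', add_smul]
      · have hT := maRho_zero_maBasis_last K p lam lam' d a (by omega)
        have hpow : ∀ n : ℕ, (maRho K p lam lam' d a 0 ^ n) (maBasis K p p) =
            lam' ^ n • maBasis K p p := fun n => by
          induction n with
          | zero => simp
          | succ n ih => rw [pow_succ', Module.End.mul_apply, ih, map_smul, hT, smul_smul, pow_succ]
        have hl' : lam' ^ p = lam' + chi 0 ^ p := by
          rw [← hlam']
          ring
        simp [hpow, hT, hl', add_smul]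
    · rw [if_neg (by omega), hheight _ (by omega), zero_pow (by omega), zero_smul, add_zero]
      refine ext_maBasis (fun l hl => ?_) ?_
      · rw [maRho_pow_maBasis K p lam lam' d a hip p hl, prod_wCoef_eq_zero K lam (by omega)
          (hl.trans_le (Nat.le_mul_of_pos_right p hj)), zero_smul, LinearMap.zero_apply]
      · rw [maRho_pow_maBasis_last K p lam lam' d a hj hip, LinearMap.zero_apply]
        by_cases hjd : j = 1 → d ≠ 0
        · rw [prod_wCoef_last_eq_zero K p lam d hp hd hj hip hjd, mul_zero, zero_smul]
        · push Not at hjd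
          obtain ⟨rfl, hdz⟩ := hjd
          have hll := hd0.mp hdz
          simp only [hlast hll, mul_one]
          have : a 1 * ∏ t ∈ Finset.range (p - 1), wCoef K lam 1 (p - 1 - t) = 0 := by
            rw [mul_eq_zero, hprod]
            tauto
          rw [this, zero_smul]
end

section
/- Let χ = 0 and let λ ∈ F_p with λ ∉ {p-1, p-2}. Then Ext(K_λ, K) = 0 in the category of restricted W_0-modules; that is, every short exact sequence 0 → K → M → K_λ → 0 of W_0-modules with p-character 0 splits, where K denotes the one-dimensional trivial W_0-module. -/
/-!
Common setup: the Witt algebra `W` over `K` (char `p > 3`) has basis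
`e_{-1}, e_0, ..., e_{p-2}` with `[e_i, e_j] = (j-i) e_{i+j}` (and `e_k = 0`
outside the range), and `p`-mapping `e_i^{[p]} = δ_{i0} e_i`.  A module with
`p`-character `χ` over `W` (resp. the subalgebra `W_0 = <e_0, ..., e_{p-2}>`)
is given by a family of endomorphisms `ρ k` (`k : ℤ`, vanishing outside
`[lo, p-2]` where `lo = -1` for `W` and `lo = 0` for `W_0`) satisfying the
bracket relations and `(ρ i)^p - δ_{i0} ρ i = χ(e_i)^p • 1`.

The Baer Ext space `Ext(N, M)` of two such modules, in the category of
modules with `p`-character `χ`, is realized concretely: an extension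
`0 → M → E → N → 0` admits a linear splitting `E ≃ M ⊕ N`, under which the
action of `e_k` is `(m, n) ↦ (ρM k m + c k n, ρN k n)` for a "cocycle"
`c : ℤ → (N →ₗ M)`; the conditions for `E` to be a module with `p`-character
`χ` are the cocycle conditions below, Baer equivalence corresponds to
differing by a coboundary, and the Baer sum / scalar action correspond to the
linear structure on cocycles.  So `Ext(N, M) ≅ cocycles / coboundaries`.
-/

set_option maxHeartbeats 1000000
set_option synthInstance.maxHeartbeats 1000000

/-- The bracket relations satisfied by the values at `1` of an extension cocycle of `K` by `K_λ`. -/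
lemma bracket_apply_one_of_mem_cocycles {K : Type} [Field K] {p : ℕ} {lam : K}
    {c : ℤ → K →ₗ[K] K} (hc : c ∈ cocycles K p 0 (trivRho K) (oneDimRho K lam)) {i j : ℤ}
    (hi : 0 ≤ i) (hi' : i ≤ (p : ℤ) - 2) (hj : 0 ≤ j) (hj' : j ≤ (p : ℤ) - 2) :
    ((j - i : ℤ) : K) * c (i + j) 1 =
      (if j = 0 then lam else 0) * c i 1 - (if i = 0 then lam else 0) * c j 1 := by
  simp only [cocycles, Submodule.mem_inf, Submodule.mem_iInf, LinearMap.mem_ker] at hc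
  have h := LinearMap.congr_fun (hc.1.2 i j) 1
  have hone : ∀ k l : ℤ, c l (oneDimRho K lam k 1) = (if k = 0 then lam else 0) * c l 1 := by
    intro k l
    rw [← smul_eq_mul, ← map_smul]
    by_cases hk : k = 0 <;> simp [oneDimRho, hk]
  simp only [bracketConstraint, hi, hi', hj, hj', and_self, if_true, LinearMap.add_apply,
    LinearMap.sub_apply, LinearMap.smul_apply, LinearMap.comp_apply, LinearMap.proj_apply,
    LinearMap.llcomp_apply, LinearMap.lcomp_apply, hone, trivRho,
    LinearMap.zero_apply, smul_eq_mul] at h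
  linear_combination h

/-- A restricted extension cocycle of `K` by `K_0` vanishes at `e_0`. -/
lemma apply_zero_of_mem_cocycles_zero {K : Type} [Field K] {p : ℕ} (hp : 1 < p)
    {c : ℤ → K →ₗ[K] K} (hc : c ∈ cocycles K p 0 (trivRho K) (oneDimRho K 0)) :
    c 0 = 0 := by
  simp only [cocycles, Submodule.mem_inf, Submodule.mem_iInf, LinearMap.mem_ker] at hc
  have h := LinearMap.congr_fun (hc.2 0) 1
  have hp2 : (0 : ℤ) ≤ (p : ℤ) - 2 := by omega
  have hsum : ∀ k ∈ Finset.range p,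
      ((0 : Module.End K K) ^ k) ((c 0) (((0 : Module.End K K) ^ (p - 1 - k)) 1)) = 0 := by
    intro k _
    rcases Nat.eq_zero_or_pos k with rfl | hk
    · rw [zero_pow (by omega : p - 1 - 0 ≠ 0), LinearMap.zero_apply, map_zero, map_zero]
    · simp [zero_pow hk.ne']
  simp only [pcharConstraint, le_refl, hp2, and_self, if_true, LinearMap.sub_apply,
    LinearMap.sum_apply, LinearMap.comp_apply, LinearMap.llcomp_apply, LinearMap.lcomp_apply,
    LinearMap.proj_apply, trivRho, oneDimRho, zero_smul, LinearMap.zero_apply,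
    Finset.sum_eq_zero hsum, zero_sub, neg_eq_zero] at h
  exact LinearMap.ext_ring h

/-- If `λ ≠ -1, -2`, an extension cocycle of `K` by `K_λ` vanishes at all `e_k` with `k ≠ 0`. -/
lemma apply_eq_zero_of_mem_cocycles {K : Type} [Field K] {p : ℕ} [CharP K p] (hp : 3 < p)
    {lam : K} (h1 : lam ≠ -1) (h2 : lam ≠ -2)
    {c : ℤ → K →ₗ[K] K} (hc : c ∈ cocycles K p 0 (trivRho K) (oneDimRho K lam))
    {k : ℤ} (hk : k ≠ 0) : c k = 0 := by
  by_cases hrange : k < 0 ∨ (p : ℤ) - 2 < k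
  · simp only [cocycles, Submodule.mem_inf, Submodule.mem_iInf, LinearMap.mem_ker] at hc
    have h := hc.1.1 k
    simpa only [suppConstraint, hrange, if_true, LinearMap.proj_apply] using h
  push Not at hrange
  apply LinearMap.ext_ring
  rw [LinearMap.zero_apply]
  rcases le_or_gt k 2 with hk2 | hk2
  · have h := bracket_apply_one_of_mem_cocycles hc (i := 0) (j := k) le_rfl (by omega)
      hrange.1 hrange.2
    simp only [hk, if_true, if_false, zero_add, sub_zero] at h
    have hmul : ((k : K) + lam) * c k 1 = 0 := by linear_combination h
    refine (mul_eq_zero.mp hmul).resolve_left fun h0 => ?_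
    obtain rfl | rfl : k = 1 ∨ k = 2 := by omega
    · exact h1 (by push_cast at h0; linear_combination h0)
    · exact h2 (by push_cast at h0; linear_combination h0)
  · have h := bracket_apply_one_of_mem_cocycles hc (i := 1) (j := k - 1) (by omega) (by omega)
      (by omega) (by omega)
    have hk1 : k - 1 ≠ 0 := by omega
    simp only [hk1, one_ne_zero, if_false, zero_mul, sub_zero, add_sub_cancel] at h
    refine (mul_eq_zero.mp h).resolve_left fun h0 => ?_
    have hdvd := Int.le_of_dvd (by omega) ((CharP.intCast_eq_zero_iff K p _).mp h0)
    omega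

/-- For `χ = 0` and `λ ∈ F_p` with `λ ∉ {p-1, p-2}`, `Ext(K_λ, K) = 0` in the
category of restricted `W_0`-modules: every short exact sequence
`0 → K → M → K_λ → 0` splits (every cocycle is a coboundary). -/
theorem ext_Klambda_trivial_eq_zero
    (K : Type) [Field K] [IsAlgClosed K] (p : ℕ) [CharP K p] (hp : 3 < p)
    (lam : K) (hlam : lam ^ p = lam)
    (h1 : lam ≠ (p : K) - 1) (h2 : lam ≠ (p : K) - 2) :
    cocycles K p 0 (trivRho K) (oneDimRho K lam) ≤
      coboundaries K p 0 (trivRho K) (oneDimRho K lam) := by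
  intro c hc
  rw [CharP.cast_eq_zero K p, zero_sub] at h1 h2
  have hne : ∀ k : ℤ, k ≠ 0 → c k = 0 := fun k hk =>
    apply_eq_zero_of_mem_cocycles hp h1 h2 hc hk
  have hp2 : (0 : ℤ) ≤ (p : ℤ) - 2 := by omega
  refine ⟨-lam⁻¹ • c 0, funext fun k => ?_⟩
  rw [LinearMap.pi_apply]
  by_cases hk : k = 0
  · subst hk
    by_cases hlam0 : lam = 0
    · subst hlam0
      simp [apply_zero_of_mem_cocycles_zero (by omega) hc]
    · rw [if_pos ⟨le_rfl, hp2⟩]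
      apply LinearMap.ext_ring
      have hlin : c 0 lam = lam * c 0 1 := by
        rw [← smul_eq_mul, ← map_smul, smul_eq_mul, mul_one]
      simp [trivRho, oneDimRho, LinearMap.lcomp_apply, hlin, hlam0]
  · rw [hne k hk]
    split_ifs
    · apply LinearMap.ext_ring
      simp [trivRho, oneDimRho, hk, LinearMap.lcomp_apply]
    · rfl
end
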